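/- Let w ∈ Ŵ be minuscule with I_w ≠ ∅. If w(α₀) + δ ∈ Δ⁺ \ Π (i.e., the rootlet of I_w is not a simple root), then I_w is not a maximal abelian ideal: there exists an abelian ideal J of Δ⁺ with I_w ⊊ J. -/

import Mathlib

open scoped BigOperators

/-- Data of a reduced irreducible crystallographic root system `Δ`, spanning a
`ℚ`-vector space `V` equipped with a Weyl-group-invariant inner product `B`,
together with a chosen system of positive roots `Pos` and the highest root `θ`. -/
structure RootSystemCtx (V : Type*) [AddCommGroup V] [Module ℚ V] where
  /-- the invariant inner product `( , )` -/
  B : V →ₗ[ℚ] V →ₗ[ℚ] ℚ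
  B_symm : ∀ x y : V, B x y = B y x
  B_posdef : ∀ x : V, x ≠ 0 → 0 < B x x
  /-- the set of roots -/
  Δ : Set V
  Δ_finite : Δ.Finite
  Δ_spans : Submodule.span ℚ Δ = ⊤
  zero_notMem_Δ : (0 : V) ∉ Δ
  neg_mem_Δ : ∀ α ∈ Δ, -α ∈ Δ
  reduced : ∀ α ∈ Δ, ∀ c : ℚ, c • α ∈ Δ → c = 1 ∨ c = -1
  crystallographic : ∀ α ∈ Δ, ∀ β ∈ Δ, ∃ n : ℤ, 2 * B α β / B β β = (n : ℚ)
  reflect_mem : ∀ α ∈ Δ, ∀ β ∈ Δ, β - (2 * B β α / B α α) • α ∈ Δ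
  irreducible : ∀ S : Set V, S ⊆ Δ → (∀ α ∈ S, ∀ β ∈ Δ \ S, B α β = 0) → S = ∅ ∨ S = Δ
  /-- the positive roots `Δ⁺` -/
  Pos : Set V
  pos_subset : Pos ⊆ Δ
  mem_pos_or_neg_pos : ∀ α ∈ Δ, α ∈ Pos ∨ -α ∈ Pos
  pos_not_neg : ∀ α ∈ Pos, -α ∉ Pos
  add_pos_mem : ∀ α ∈ Pos, ∀ β ∈ Pos, α + β ∈ Δ → α + β ∈ Pos
  /-- the highest root `θ` -/
  θ : V
  θ_pos : θ ∈ Pos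
  θ_highest : ∀ ν ∈ Δ, θ - ν ∈ AddSubmonoid.closure Pos

namespace RootSystemCtx

variable {V : Type*} [AddCommGroup V] [Module ℚ V] (ctx : RootSystemCtx V)

/-- the simple roots `Π`: indecomposable positive roots -/
def simple : Set V :=
  {α | α ∈ ctx.Pos ∧ ¬∃ β ∈ ctx.Pos, ∃ γ ∈ ctx.Pos, α = β + γ}

/-- `ρ`, the half-sum of all positive roots -/
noncomputable def ρ : V :=
  (1 / 2 : ℚ) • ∑ α ∈ (ctx.Δ_finite.subset ctx.pos_subset).toFinset, α

/-- the coroot `μ∨ = 2μ/(μ,μ)` -/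
noncomputable def coroot (μ : V) : V := (2 / ctx.B μ μ) • μ

/-- `Δ⁺_l`, the long positive roots (roots of the same length as `θ`) -/
def PosLong : Set V := {μ | μ ∈ ctx.Pos ∧ ctx.B μ μ = ctx.B ctx.θ ctx.θ}

/-- `Π_l`, the long simple roots -/
def SimpleLong : Set V := {μ | μ ∈ ctx.simple ∧ ctx.B μ μ = ctx.B ctx.θ ctx.θ}

/-- the dominance order `μ ≼ ν` on the root lattice: `ν - μ` is a nonnegative
integer combination of positive roots -/
def le (μ ν : V) : Prop := ν - μ ∈ AddSubmonoid.closure ctx.Pos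

/-- a (combinatorial) abelian ideal of `Δ⁺` -/
def IsAbelianIdeal (I : Set V) : Prop :=
  I ⊆ ctx.Pos ∧ (∀ μ ∈ I, ∀ ν ∈ I, μ + ν ∉ ctx.Δ) ∧
    ∀ γ ∈ I, ∀ ν ∈ ctx.Pos, γ + ν ∈ ctx.Δ → γ + ν ∈ I

/-- `γ` is a generator of the ideal `I` -/
def IsGenerator (I : Set V) (γ : V) : Prop := γ ∈ I ∧ ∀ α ∈ ctx.Pos, γ - α ∉ I

/-! ### The affine picture: `V̂ = V ⊕ ℚδ ⊕ ℚλ`, modelled as `V × ℚ × ℚ`,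
with `δ = (0,1,0)` and `λ = (0,0,1)`. -/

/-- the embedding of `V` into `V̂` -/
def emb (_ctx : RootSystemCtx V) (v : V) : V × ℚ × ℚ := (v, 0, 0)

/-- the imaginary root `δ` -/
def δhat (_ctx : RootSystemCtx V) : V × ℚ × ℚ := (0, 1, 0)

/-- the affine simple root `α₀ = δ - θ` -/
def alpha0 : V × ℚ × ℚ := (-ctx.θ, 1, 0)

/-- the extension of the inner product to `V̂`, with
`(δ,V)=(λ,V)=(δ,δ)=(λ,λ)=0` and `(δ,λ)=1` -/
noncomputable def Bhat : (V × ℚ × ℚ) →ₗ[ℚ] (V × ℚ × ℚ) →ₗ[ℚ] ℚ :=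
  LinearMap.mk₂ ℚ (fun x y => ctx.B x.1 y.1 + x.2.1 * y.2.2 + x.2.2 * y.2.1)
    (fun x x' y => by
      simp only [Prod.fst_add, Prod.snd_add, map_add, LinearMap.add_apply]; ring)
    (fun c x y => by
      simp only [Prod.smul_fst, Prod.smul_snd, map_smul, LinearMap.smul_apply,
        smul_eq_mul]; ring)
    (fun x y y' => by
      simp only [Prod.fst_add, Prod.snd_add, map_add]; ring)
    (fun c x y => by
      simp only [Prod.smul_fst, Prod.smul_snd, map_smul, smul_eq_mul]; ring)

/-- the set `Δ̂` of affine real roots -/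
def Δhat : Set (V × ℚ × ℚ) := {x | ∃ α ∈ ctx.Δ, ∃ k : ℤ, x = (α, (k : ℚ), 0)}

/-- the set `Δ̂⁺` of positive affine roots -/
def PosHat : Set (V × ℚ × ℚ) :=
  {x | ∃ α ∈ ctx.Pos, x = (α, 0, 0)} ∪
    {x | ∃ α ∈ ctx.Δ, ∃ k : ℤ, 1 ≤ k ∧ x = (α, (k : ℚ), 0)}

/-- the set `Π̂ = Π ∪ {α₀}` of affine simple roots -/
def SimpleHat : Set (V × ℚ × ℚ) :=
  {x | ∃ α ∈ ctx.simple, x = (α, (0 : ℚ), (0 : ℚ))} ∪ {ctx.alpha0}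

/-- the reflection `s_β : x ↦ x − (2(x,β)/(β,β))·β` in `V̂` -/
noncomputable def refl (β : V × ℚ × ℚ) : (V × ℚ × ℚ) ≃ₗ[ℚ] (V × ℚ × ℚ) :=
  if h : ctx.Bhat β β = 0 then LinearEquiv.refl ℚ _
  else
    Module.reflection (x := β) (f := (2 / ctx.Bhat β β) • ctx.Bhat β)
      (by simp only [LinearMap.smul_apply, smul_eq_mul]; field_simp)

/-- the affine Weyl group `Ŵ`, generated by the reflections `s_β`, `β ∈ Δ̂` -/
def What : Subgroup ((V × ℚ × ℚ) ≃ₗ[ℚ] (V × ℚ × ℚ)) :=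
  Subgroup.closure {g | ∃ β ∈ ctx.Δhat, g = ctx.refl β}

/-- the finite Weyl group `W`, generated by the reflections `s_α`, `α ∈ Δ`
(identified with a subgroup of `Ŵ`) -/
def Wfin : Subgroup ((V × ℚ × ℚ) ≃ₗ[ℚ] (V × ℚ × ℚ)) :=
  Subgroup.closure {g | ∃ α ∈ ctx.Δ, g = ctx.refl (α, (0 : ℚ), (0 : ℚ))}

/-- `N̂(w) = {β ∈ Δ̂⁺ : w(β) ∈ −Δ̂⁺}` -/
def Nhat (w : (V × ℚ × ℚ) ≃ₗ[ℚ] (V × ℚ × ℚ)) : Set (V × ℚ × ℚ) :=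
  {β | β ∈ ctx.PosHat ∧ -(w β) ∈ ctx.PosHat}

/-- a minuscule element of `Ŵ`: every element of `N̂(w)` has the form `δ - γ`
with `γ ∈ Δ⁺` -/
def IsMinuscule (w : (V × ℚ × ℚ) ≃ₗ[ℚ] (V × ℚ × ℚ)) : Prop :=
  w ∈ ctx.What ∧ ∀ β ∈ ctx.Nhat w, ∃ γ ∈ ctx.Pos, β = ctx.δhat - ctx.emb γ

/-- the abelian ideal `I_w` corresponding to a minuscule element `w` -/
def idealOf (w : (V × ℚ × ℚ) ≃ₗ[ℚ] (V × ℚ × ℚ)) : Set V :=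
  {γ | γ ∈ ctx.Pos ∧ ctx.δhat - ctx.emb γ ∈ ctx.Nhat w}

/-- the ideal `I` has rootlet `τ(I) = μ`, i.e. `I = I_w` for some minuscule `w`
with `w(α₀) + δ = μ` -/
def HasRootlet (I : Set V) (μ : V) : Prop :=
  ∃ w, ctx.IsMinuscule w ∧ ctx.idealOf w = I ∧ w ctx.alpha0 + ctx.δhat = ctx.emb μ

/-- `Ab_μ`, the set of nonempty abelian ideals with rootlet `μ` -/
def AbFiber (μ : V) : Set (Set V) := {I | I.Nonempty ∧ ctx.HasRootlet I μ}

/-- `N(u) = {γ ∈ Δ⁺ : u(γ) ∈ −Δ⁺}` for `u` in the finite Weyl group -/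
def Nfin (w : (V × ℚ × ℚ) ≃ₗ[ℚ] (V × ℚ × ℚ)) : Set V :=
  {γ | γ ∈ ctx.Pos ∧ -(w (ctx.emb γ)) ∈ ctx.PosHat}

/-- the length `l(u) = #N(u)` of an element of the finite Weyl group -/
noncomputable def lenFin (w : (V × ℚ × ℚ) ≃ₗ[ℚ] (V × ℚ × ℚ)) : ℕ :=
  (ctx.Nfin w).ncard

end RootSystemCtx
namespace RootSystemCtx

variable {V : Type*} [AddCommGroup V] [Module ℚ V] (ctx : RootSystemCtx V)

theorem B_self_pos {a : V} (ha : a ∈ ctx.Δ) : 0 < ctx.B a a :=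
  ctx.B_posdef a fun h => ctx.zero_notMem_Δ (h ▸ ha)

theorem sub_mem_of_B_pos {a b : V} (ha : a ∈ ctx.Δ) (hb : b ∈ ctx.Δ)
    (hab : 0 < ctx.B a b) (hne : a ≠ b) : a - b ∈ ctx.Δ := by
  have haa := ctx.B_self_pos ha
  have hbb := ctx.B_self_pos hb
  obtain ⟨n, hn⟩ := ctx.crystallographic a ha b hb
  obtain ⟨m, hm⟩ := ctx.crystallographic b hb a ha
  have hba : ctx.B b a = ctx.B a b := ctx.B_symm b a
  have hra := ctx.reflect_mem a ha b hb
  have hrb := ctx.reflect_mem b hb a ha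
  rw [hm] at hra
  rw [hn] at hrb
  rw [hba] at hm
  have hn0 : 0 < n := by
    have : (0 : ℚ) < n := by rw [← hn]; positivity
    exact_mod_cast this
  have hm0 : 0 < m := by
    have : (0 : ℚ) < m := by rw [← hm]; positivity
    exact_mod_cast this
  have hn' : 2 * ctx.B a b = n * ctx.B b b := by rw [← hn]; field_simp
  have hm' : 2 * ctx.B a b = m * ctx.B a a := by rw [← hm]; field_simp
  -- strict Cauchy–Schwarz for non-proportional roots
  have hne0 : ctx.B b b • a - ctx.B a b • b ≠ 0 := by
    intro h
    have h1 : (ctx.B a b / ctx.B b b) • b = a := by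
      rw [sub_eq_zero] at h
      rw [div_eq_inv_mul, mul_smul, ← h, smul_smul, inv_mul_cancel₀ hbb.ne', one_smul]
    rcases ctx.reduced b hb _ (h1 ▸ ha) with h2 | h2
    · rw [h2, one_smul] at h1
      exact hne h1.symm
    · have : 0 < ctx.B a b / ctx.B b b := by positivity
      linarith
  have hcs := ctx.B_posdef _ hne0
  have hcs' : ctx.B a b * ctx.B a b < ctx.B a a * ctx.B b b := by
    simp only [map_sub, map_smul, LinearMap.sub_apply, LinearMap.smul_apply, smul_eq_mul,
      hba] at hcs
    by_contra! hle
    nlinarith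
  have hnm : n * m < 4 := by
    have : ((n : ℚ) * m) * (ctx.B a a * ctx.B b b) < 4 * (ctx.B a a * ctx.B b b) := by
      calc ((n : ℚ) * m) * (ctx.B a a * ctx.B b b)
          = (n * ctx.B b b) * (m * ctx.B a a) := by ring
        _ = 4 * (ctx.B a b * ctx.B a b) := by rw [← hn', ← hm']; ring
        _ < _ := by linarith
    have := lt_of_mul_lt_mul_right this (by positivity)
    exact_mod_cast this
  have h1 : n = 1 ∨ m = 1 := by
    by_contra! h
    have : 2 ≤ n := by omega
    have : 2 ≤ m := by omega
    nlinarith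
  rcases h1 with rfl | rfl
  · simpa using hrb
  · simpa using ctx.neg_mem_Δ _ hra

theorem add_mem_of_B_neg {a b : V} (ha : a ∈ ctx.Δ) (hb : b ∈ ctx.Δ)
    (hab : ctx.B a b < 0) (hne : a ≠ -b) : a + b ∈ ctx.Δ := by
  have := ctx.sub_mem_of_B_pos ha (ctx.neg_mem_Δ b hb) (by simpa using hab) hne
  simpa using this

theorem exists_pos_of_sum_pos (x : V) (s : Multiset V) (h : 0 < ctx.B x s.sum) :
    ∃ y ∈ s, 0 < ctx.B x y := by
  induction s using Multiset.induction_on with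
  | empty => simp at h
  | cons a t ih =>
    rw [Multiset.sum_cons, map_add] at h
    rcases lt_or_ge 0 (ctx.B x a) with ha | ha
    · exact ⟨a, by simp, ha⟩
    · obtain ⟨y, hy, hxy⟩ := ih (by linarith)
      exact ⟨y, Multiset.mem_cons_of_mem hy, hxy⟩

theorem multiset_sum_ne_zero (s : Multiset V) (hs : ∀ x ∈ s, x ∈ ctx.Pos) (h0 : s ≠ 0) :
    s.sum ≠ 0 := by
  induction hn : s.card using Nat.strong_induction_on generalizing s with
  | _ n ih =>
    intro hsum
    obtain ⟨a, ha⟩ := Multiset.exists_mem_of_ne_zero h0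
    obtain ⟨t, rfl⟩ := Multiset.exists_cons_of_mem ha
    have haP := hs a ha
    have haa := ctx.B_self_pos (ctx.pos_subset haP)
    rw [Multiset.sum_cons] at hsum
    obtain ⟨b, hb, hab⟩ := ctx.exists_pos_of_sum_pos (-a) t (by
      rw [← neg_eq_of_add_eq_zero_right hsum]; simpa using haa)
    obtain ⟨u, rfl⟩ := Multiset.exists_cons_of_mem hb
    have hbP : b ∈ ctx.Pos := hs b (by simp)
    have hroot := ctx.add_mem_of_B_neg (ctx.pos_subset haP) (ctx.pos_subset hbP)
      (by simpa using hab) (fun h => ctx.pos_not_neg b hbP (h ▸ haP))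
    refine ih (u.card + 1) (by simp at hn; omega) ((a + b) ::ₘ u) ?_ (by simp) (by simp) ?_
    · intro x hx
      rcases Multiset.mem_cons.1 hx with rfl | hx
      · exact ctx.add_pos_mem a haP b hbP hroot
      · exact hs x (by simp [hx])
    · rw [← hsum]
      simp [add_assoc]

theorem neg_notMem_closure {a : V} (ha : a ∈ ctx.Pos) : -a ∉ AddSubmonoid.closure ctx.Pos := by
  intro h
  obtain ⟨s, hs, hsum⟩ := AddSubmonoid.exists_multiset_of_mem_closure h
  refine ctx.multiset_sum_ne_zero (a ::ₘ s) ?_ (by simp) (by simp [hsum])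
  intro x hx
  rcases Multiset.mem_cons.1 hx with rfl | hx
  exacts [ha, hs x hx]

theorem pos_of_mem_closure {a : V} (ha : a ∈ ctx.Δ) (h : a ∈ AddSubmonoid.closure ctx.Pos) :
    a ∈ ctx.Pos :=
  (ctx.mem_pos_or_neg_pos a ha).resolve_right fun hn =>
    ctx.neg_notMem_closure hn (by simpa using h)

theorem exists_simple_B_pos {x a : V} (ha : a ∈ ctx.Pos) (hxa : 0 < ctx.B x a) :
    ∃ b ∈ ctx.simple, 0 < ctx.B x b := by
  let r : ctx.Pos → ctx.Pos → Prop := fun b c =>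
    ∃ s : Multiset V, (∀ y ∈ s, y ∈ ctx.Pos) ∧ s ≠ 0 ∧ (c : V) = b + s.sum
  have : Finite ctx.Pos := ctx.Δ_finite.subset ctx.pos_subset
  have : IsTrans ctx.Pos r := ⟨by
    rintro b c d ⟨s, hs, hs0, h⟩ ⟨t, ht, -, h'⟩
    refine ⟨s + t, fun y hy => (Multiset.mem_add.1 hy).elim (hs y) (ht y), by simp [hs0], ?_⟩
    rw [h', h, Multiset.sum_add, add_assoc]⟩
  have : Std.Irrefl r := ⟨by
    rintro b ⟨s, hs, hs0, h⟩
    exact ctx.multiset_sum_ne_zero s hs hs0 (by simpa using h)⟩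
  have hwf : WellFounded r := Finite.wellFounded_of_trans_of_irrefl r
  obtain ⟨⟨b, hb⟩, hxb, hmin⟩ := hwf.has_min {c : ctx.Pos | 0 < ctx.B x c} ⟨⟨a, ha⟩, hxa⟩
  refine ⟨b, ⟨hb, ?_⟩, hxb⟩
  rintro ⟨c, hc, d, hd, rfl⟩
  have h : 0 < ctx.B x c ∨ 0 < ctx.B x d := by
    by_contra! h
    have : 0 < ctx.B x (c + d) := hxb
    rw [map_add] at this
    linarith [h.1, h.2]
  rcases h with h | h
  · exact hmin ⟨c, hc⟩ h ⟨{d}, by simpa using hd, by simp, by simp⟩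
  · exact hmin ⟨d, hd⟩ h ⟨{c}, by simpa using hc, by simp, by simp [add_comm]⟩

theorem sub_simple_mem_pos {a b : V} (ha : a ∈ ctx.simple) (hb : b ∈ ctx.Pos)
    (h : b - a ∈ ctx.Δ) : b - a ∈ ctx.Pos :=
  (ctx.mem_pos_or_neg_pos _ h).resolve_right fun hn => ha.2 ⟨b, hb, -(b - a), hn, by abel⟩

theorem exists_simple_sub_mem_pos {x : V} (hx : x ∈ ctx.Pos) (hns : x ∉ ctx.simple) :
    ∃ a ∈ ctx.simple, x - a ∈ ctx.Pos := by
  obtain ⟨a, ha, hxa⟩ := ctx.exists_simple_B_pos hx (ctx.B_self_pos (ctx.pos_subset hx))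
  exact ⟨a, ha, ctx.sub_simple_mem_pos ha hx (ctx.sub_mem_of_B_pos (ctx.pos_subset hx)
    (ctx.pos_subset ha.1) hxa fun h => hns (h ▸ ha))⟩

theorem θ_sub_mem_pos {b : V} (hb : b ∈ ctx.Δ) (h : ctx.θ - b ∈ ctx.Δ) : ctx.θ - b ∈ ctx.Pos :=
  ctx.pos_of_mem_closure h (ctx.θ_highest b hb)

theorem mem_pos_of_θ_sub_mem {b : V} (hb : b ∈ ctx.Δ) (h : ctx.θ - b ∈ ctx.Δ) : b ∈ ctx.Pos := by
  simpa using ctx.θ_sub_mem_pos h (by simpa using hb)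

/-! ### Affine roots -/

theorem refl_mem_Δhat {x y : V × ℚ × ℚ} (hx : x ∈ ctx.Δhat) (hy : y ∈ ctx.Δhat) :
    ctx.refl x y ∈ ctx.Δhat := by
  obtain ⟨a, ha, k, rfl⟩ := hx
  obtain ⟨b, hb, l, rfl⟩ := hy
  obtain ⟨n, hn⟩ := ctx.crystallographic b hb a ha
  have haa := ctx.B_self_pos ha
  have hr := ctx.reflect_mem a ha b hb
  rw [hn] at hr
  have hB : ctx.Bhat (a, (k : ℚ), 0) (a, (k : ℚ), 0) = ctx.B a a := by simp [Bhat]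
  have hB' : ctx.Bhat (a, (k : ℚ), 0) (b, (l : ℚ), 0) = ctx.B b a := by
    simp [Bhat, ctx.B_symm a b]
  refine ⟨_, hr, l - n * k, ?_⟩
  rw [refl, dif_neg (by rw [hB]; exact haa.ne'), Module.reflection_apply]
  have hc : 2 / ctx.B a a * ctx.B b a = n := by rw [← hn]; ring
  simp [hB, hB', hc]

theorem refl_δhat {x : V × ℚ × ℚ} (hx : x ∈ ctx.Δhat) : ctx.refl x ctx.δhat = ctx.δhat := by
  obtain ⟨a, ha, k, rfl⟩ := hx
  rw [refl]
  split_ifs with h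
  · rfl
  · rw [Module.reflection_apply]
    simp [Bhat, δhat]

theorem What_apply {w : (V × ℚ × ℚ) ≃ₗ[ℚ] (V × ℚ × ℚ)} (hw : w ∈ ctx.What) :
    (∀ x ∈ ctx.Δhat, w x ∈ ctx.Δhat) ∧ w ctx.δhat = ctx.δhat := by
  have hinv : ∀ x ∈ ctx.Δhat, (ctx.refl x)⁻¹ = ctx.refl x := by
    intro x _
    rw [refl]
    split_ifs
    · rfl
    · rfl
  induction hw using Subgroup.closure_induction'' with
  | one => exact ⟨fun x hx => hx, rfl⟩
  | mem g hg =>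
    obtain ⟨b, hb, rfl⟩ := hg
    exact ⟨fun x hx => ctx.refl_mem_Δhat hb hx, ctx.refl_δhat hb⟩
  | inv_mem g hg =>
    obtain ⟨b, hb, rfl⟩ := hg
    rw [hinv b hb]
    exact ⟨fun x hx => ctx.refl_mem_Δhat hb hx, ctx.refl_δhat hb⟩
  | mul g h _ _ hg hh =>
    refine ⟨fun x hx => hg.1 _ (hh.1 x hx), ?_⟩
    rw [LinearEquiv.mul_apply, hh.2, hg.2]

theorem PosHat_subset : ctx.PosHat ⊆ ctx.Δhat := by
  rintro x (⟨a, ha, rfl⟩ | ⟨a, ha, k, -, rfl⟩)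
  · exact ⟨a, ctx.pos_subset ha, 0, by simp⟩
  · exact ⟨a, ha, k, rfl⟩

theorem mem_PosHat_iff {a : V} {k : ℤ} :
    ((a, (k : ℚ), 0) : V × ℚ × ℚ) ∈ ctx.PosHat ↔
      (k = 0 ∧ a ∈ ctx.Pos) ∨ (1 ≤ k ∧ a ∈ ctx.Δ) := by
  constructor
  · rintro (⟨b, hb, h⟩ | ⟨b, hb, l, hl, h⟩)
    · simp only [Prod.mk.injEq, Int.cast_eq_zero, and_true] at h
      exact Or.inl ⟨h.2, h.1 ▸ hb⟩
    · simp only [Prod.mk.injEq, Int.cast_inj, and_true] at h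
      exact Or.inr ⟨h.2 ▸ hl, h.1 ▸ hb⟩
  · rintro (⟨rfl, h⟩ | ⟨hk, h⟩)
    · exact Or.inl ⟨a, h, by simp⟩
    · exact Or.inr ⟨a, h, k, hk, rfl⟩

theorem mem_PosHat_or_neg {x : V × ℚ × ℚ} (hx : x ∈ ctx.Δhat) :
    x ∈ ctx.PosHat ∨ -x ∈ ctx.PosHat := by
  obtain ⟨a, ha, k, rfl⟩ := hx
  have hneg : -((a, (k : ℚ), 0) : V × ℚ × ℚ) = (-a, ((-k : ℤ) : ℚ), 0) := by simp
  rw [hneg, mem_PosHat_iff, mem_PosHat_iff]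
  have := ctx.neg_mem_Δ a ha
  have := ctx.mem_pos_or_neg_pos a ha
  rcases lt_trichotomy k 0 with h | h | h
  · exact Or.inr (Or.inr ⟨by omega, by assumption⟩)
  · simp [h, this]
  · exact Or.inl (Or.inr ⟨by omega, ha⟩)

theorem neg_notMem_PosHat {x : V × ℚ × ℚ} (hx : x ∈ ctx.PosHat) : -x ∉ ctx.PosHat := by
  obtain ⟨a, ha, k, rfl⟩ := ctx.PosHat_subset hx
  have hneg : -((a, (k : ℚ), 0) : V × ℚ × ℚ) = (-a, ((-k : ℤ) : ℚ), 0) := by simp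
  rw [hneg, mem_PosHat_iff]
  rw [mem_PosHat_iff] at hx
  rintro (⟨h, h'⟩ | ⟨h, -⟩)
  · rcases hx with ⟨-, hx⟩ | ⟨hx, -⟩
    · exact ctx.pos_not_neg a hx h'
    · omega
  · omega

theorem add_mem_PosHat {x y : V × ℚ × ℚ} (hx : x ∈ ctx.PosHat) (hy : y ∈ ctx.PosHat)
    (h : x + y ∈ ctx.Δhat) : x + y ∈ ctx.PosHat := by
  obtain ⟨a, ha, k, rfl⟩ := ctx.PosHat_subset hx
  obtain ⟨b, hb, l, rfl⟩ := ctx.PosHat_subset hy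
  have hadd : ((a, (k : ℚ), 0) : V × ℚ × ℚ) + (b, (l : ℚ), 0) = (a + b, ((k + l : ℤ) : ℚ), 0) := by
    simp
  obtain ⟨c, hc, m, hm⟩ := h
  have hab : a + b ∈ ctx.Δ := by
    rw [hadd, Prod.mk.injEq] at hm
    exact hm.1 ▸ hc
  rw [hadd, mem_PosHat_iff]
  rw [mem_PosHat_iff] at hx hy
  rcases hx with ⟨h1, h2⟩ | ⟨h1, -⟩
  · rcases hy with ⟨h3, h4⟩ | ⟨h3, -⟩
    · exact Or.inl ⟨by omega, ctx.add_pos_mem a h2 b h4 hab⟩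
    · exact Or.inr ⟨by omega, hab⟩
  · rcases hy with ⟨h3, -⟩ | ⟨h3, -⟩ <;> exact Or.inr ⟨by omega, hab⟩

theorem sub_simple_mem_PosHat {x : V × ℚ × ℚ} {a : V} (hx : x ∈ ctx.PosHat)
    (ha : a ∈ ctx.simple) (h : x - ctx.emb a ∈ ctx.Δhat) : x - ctx.emb a ∈ ctx.PosHat := by
  obtain ⟨b, hb, k, rfl⟩ := ctx.PosHat_subset hx
  have hsub : ((b, (k : ℚ), 0) : V × ℚ × ℚ) - ctx.emb a = (b - a, (k : ℚ), 0) := by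
    simp [emb]
  obtain ⟨c, hc, m, hm⟩ := h
  have hba : b - a ∈ ctx.Δ := by
    rw [hsub, Prod.mk.injEq] at hm
    exact hm.1 ▸ hc
  rw [hsub, mem_PosHat_iff]
  rw [mem_PosHat_iff] at hx
  rcases hx with ⟨h1, h2⟩ | ⟨h1, -⟩
  · exact Or.inl ⟨h1, ctx.sub_simple_mem_pos ha h2 hba⟩
  · exact Or.inr ⟨h1, hba⟩

theorem mem_Δhat_of_mem {a : V} (ha : a ∈ ctx.Δ) (k : ℤ) :
    ctx.emb a + (k : ℚ) • ctx.δhat ∈ ctx.Δhat :=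
  ⟨a, ha, k, by simp [emb, δhat]⟩

theorem emb_mem_PosHat {a : V} (ha : a ∈ ctx.Pos) : ctx.emb a ∈ ctx.PosHat :=
  Or.inl ⟨a, ha, rfl⟩

theorem emb_add (a b : V) : ctx.emb (a + b) = ctx.emb a + ctx.emb b := by simp [emb]

theorem map_mem_PosHat_of_not_form {w : (V × ℚ × ℚ) ≃ₗ[ℚ] (V × ℚ × ℚ)} (hw : ctx.IsMinuscule w)
    {a : V} {k : ℤ} (hx : ((a, (k : ℚ), 0) : V × ℚ × ℚ) ∈ ctx.PosHat)
    (h : k = 1 → a ∈ ctx.Pos) : w (a, (k : ℚ), 0) ∈ ctx.PosHat := by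
  refine (ctx.mem_PosHat_or_neg ((ctx.What_apply hw.1).1 _ (ctx.PosHat_subset hx))).resolve_right
    fun hn => ?_
  obtain ⟨c, hc, hac⟩ := hw.2 _ ⟨hx, hn⟩
  simp only [δhat, emb, Prod.mk_sub_mk, sub_zero, zero_sub, Prod.mk.injEq, Int.cast_eq_one,
    and_true] at hac
  have := h hac.2
  rw [hac.1] at this
  exact ctx.pos_not_neg c hc this

theorem map_emb_mem_PosHat {w : (V × ℚ × ℚ) ≃ₗ[ℚ] (V × ℚ × ℚ)} (hw : ctx.IsMinuscule w)
    {a : V} (ha : a ∈ ctx.Pos) : w (ctx.emb a) ∈ ctx.PosHat := by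
  have h0 : ctx.emb a = (a, ((0 : ℤ) : ℚ), 0) := by simp [emb]
  have := ctx.emb_mem_PosHat ha
  rw [h0] at this ⊢
  exact ctx.map_mem_PosHat_of_not_form hw this (by simp)

theorem map_emb_sub_notMem_PosHat {w : (V × ℚ × ℚ) ≃ₗ[ℚ] (V × ℚ × ℚ)} (hw : ctx.IsMinuscule w)
    {a : V} (ha : a ∈ ctx.Δ) : w (ctx.emb a) - (2 : ℚ) • ctx.δhat ∉ ctx.PosHat := by
  have h := ctx.map_mem_PosHat_of_not_form hw (a := -a) (k := 2)
    (ctx.mem_PosHat_iff.2 (Or.inr ⟨by norm_num, ctx.neg_mem_Δ a ha⟩)) (by norm_num)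
  have he : ((-a, ((2 : ℤ) : ℚ), 0) : V × ℚ × ℚ) = (2 : ℚ) • ctx.δhat - ctx.emb a := by
    simp [emb, δhat]
  rw [he, map_sub, map_smul, (ctx.What_apply hw.1).2] at h
  simpa using ctx.neg_notMem_PosHat h

theorem mem_idealOf_iff {w : (V × ℚ × ℚ) ≃ₗ[ℚ] (V × ℚ × ℚ)} (hw : w ∈ ctx.What) {a : V} :
    a ∈ ctx.idealOf w ↔ a ∈ ctx.Pos ∧ w (ctx.emb a) - ctx.δhat ∈ ctx.PosHat := by
  refine and_congr_right fun ha => ?_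
  have h : ctx.δhat - ctx.emb a ∈ ctx.PosHat :=
    Or.inr ⟨-a, ctx.neg_mem_Δ a (ctx.pos_subset ha), 1, le_rfl, by simp [emb, δhat]⟩
  simp [Nhat, h, (ctx.What_apply hw).2]

/-- If `w(ν) = δ - α` with `w` minuscule and `α` a simple root, then adjoining `ν` to `I_w`
gives an abelian ideal. -/
theorem isAbelianIdeal_insert {w : (V × ℚ × ℚ) ≃ₗ[ℚ] (V × ℚ × ℚ)} (hw : ctx.IsMinuscule w)
    {α ν : V} (hα : α ∈ ctx.simple) (hν : ν ∈ ctx.Pos)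
    (hwν : w (ctx.emb ν) = ctx.δhat - ctx.emb α) :
    ctx.IsAbelianIdeal (insert ν (ctx.idealOf w)) := by
  have hmap : ∀ {a : V}, a ∈ ctx.Δ → ∀ k : ℤ,
      w (ctx.emb a) + (k : ℚ) • ctx.δhat ∈ ctx.Δhat := by
    intro a ha k
    have := (ctx.What_apply hw.1).1 _ (ctx.mem_Δhat_of_mem ha k)
    rwa [map_add, map_smul, (ctx.What_apply hw.1).2] at this
  have hmixed : ∀ γ ∈ ctx.idealOf w, γ + ν ∉ ctx.Δ := by
    intro γ hγ hsum
    rw [ctx.mem_idealOf_iff hw.1] at hγ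
    have he : w (ctx.emb (γ + ν)) - (2 : ℚ) • ctx.δhat
        = (w (ctx.emb γ) - ctx.δhat) - ctx.emb α := by
      rw [emb_add, map_add, hwν]; module
    refine ctx.map_emb_sub_notMem_PosHat hw hsum ?_
    rw [he]
    refine ctx.sub_simple_mem_PosHat hγ.2 hα ?_
    rw [← he]
    convert hmap hsum (-2) using 1
    push_cast; module
  refine ⟨?_, ?_, ?_⟩
  · rintro γ (rfl | hγ)
    exacts [hν, hγ.1]
  · rintro γ (rfl | hγ) γ' (rfl | hγ') hsum
    · rcases ctx.reduced _ (ctx.pos_subset hν) 2 (by rwa [two_smul]) with h | h <;> norm_num at h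
    · exact hmixed _ hγ' (add_comm γ γ' ▸ hsum)
    · exact hmixed _ hγ hsum
    · rw [ctx.mem_idealOf_iff hw.1] at hγ hγ'
      have he : w (ctx.emb (γ + γ')) - (2 : ℚ) • ctx.δhat
          = (w (ctx.emb γ) - ctx.δhat) + (w (ctx.emb γ') - ctx.δhat) := by
        rw [emb_add, map_add]; module
      refine ctx.map_emb_sub_notMem_PosHat hw hsum ?_
      rw [he]
      refine ctx.add_mem_PosHat hγ.2 hγ'.2 ?_
      rw [← he]
      convert hmap hsum (-2) using 1
      push_cast; module
  · intro γ hγ β hβ hsum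
    have hroot : w (ctx.emb (γ + β)) - ctx.δhat ∈ ctx.Δhat := by
      convert hmap hsum (-1) using 1
      push_cast; module
    have hwβ := ctx.map_emb_mem_PosHat hw hβ
    refine Or.inr ((ctx.mem_idealOf_iff hw.1).2 ?_)
    rcases hγ with rfl | hγ
    · have he : w (ctx.emb (γ + β)) - ctx.δhat = w (ctx.emb β) - ctx.emb α := by
        rw [emb_add, map_add, hwν]; abel
      rw [he] at hroot ⊢
      exact ⟨ctx.add_pos_mem _ hν _ hβ hsum, ctx.sub_simple_mem_PosHat hwβ hα hroot⟩
    · rw [ctx.mem_idealOf_iff hw.1] at hγ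
      have he : w (ctx.emb (γ + β)) - ctx.δhat
          = (w (ctx.emb γ) - ctx.δhat) + w (ctx.emb β) := by
        rw [emb_add, map_add]; abel
      rw [he] at hroot ⊢
      exact ⟨ctx.add_pos_mem _ hγ.1 _ hβ hsum, ctx.add_mem_PosHat hγ.2 hwβ hroot⟩

end RootSystemCtx

/-- Theorem `not-max` 2: if the rootlet of `I_w` is not a simple
root, then `I_w` is not a maximal abelian ideal. -/
theorem statement_5 {V : Type*} [AddCommGroup V] [Module ℚ V] (ctx : RootSystemCtx V)
    (w : (V × ℚ × ℚ) ≃ₗ[ℚ] (V × ℚ × ℚ)) (hw : ctx.IsMinuscule w)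
    (hne : (ctx.idealOf w).Nonempty)
    (μ : V) (hroot : w ctx.alpha0 + ctx.δhat = ctx.emb μ)
    (hμpos : μ ∈ ctx.Pos) (hμns : μ ∉ ctx.simple) :
    ∃ J : Set V, ctx.IsAbelianIdeal J ∧ ctx.idealOf w ⊂ J := by
  obtain ⟨α, hα, hμα⟩ := ctx.exists_simple_sub_mem_pos hμpos hμns
  have hδ := (ctx.What_apply hw.1).2
  have hinv := (ctx.What_apply (ctx.What.inv_mem hw.1)).1
  obtain ⟨ν', hν', k, hk⟩ := hinv _ (ctx.PosHat_subset (ctx.emb_mem_PosHat hα.1))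
  obtain ⟨ξ, hξ, l, hl⟩ := hinv _ (ctx.PosHat_subset (ctx.emb_mem_PosHat hμα))
  have hwk : w (ν', (k : ℚ), 0) = ctx.emb α := by
    rw [← hk]; exact w.apply_symm_apply _
  have hwl : w (ξ, (l : ℚ), 0) = ctx.emb (μ - α) := by
    rw [← hl]; exact w.apply_symm_apply _
  have hsum : ((ν', (k : ℚ), 0) : V × ℚ × ℚ) + (ξ, (l : ℚ), 0) = (-ctx.θ, (2 : ℚ), 0) := by
    apply w.injective
    have he : ((-ctx.θ, (2 : ℚ), 0) : V × ℚ × ℚ) = ctx.alpha0 + ctx.δhat := by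
      simp [RootSystemCtx.alpha0, RootSystemCtx.δhat]; norm_num
    rw [map_add, hwk, hwl, he, map_add, hδ, hroot, ← ctx.emb_add, add_sub_cancel]
  simp only [Prod.mk_add_mk, Prod.mk.injEq, add_zero, and_true] at hsum
  obtain ⟨hθ, hkl⟩ := hsum
  have hkl : k + l = 2 := by exact_mod_cast hkl
  have hξ' : ctx.θ - (-ν') = -ξ := by
    rw [← neg_neg ctx.θ, ← hθ]; abel
  have hνpos : -ν' ∈ ctx.Pos := ctx.mem_pos_of_θ_sub_mem (ctx.neg_mem_Δ _ hν')
    (hξ' ▸ ctx.neg_mem_Δ _ hξ)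
  have hξpos : -ξ ∈ ctx.Pos := hξ' ▸ ctx.θ_sub_mem_pos (ctx.neg_mem_Δ _ hν')
    (hξ' ▸ ctx.neg_mem_Δ _ hξ)
  have hlevel : ∀ {a b : V} {m : ℤ}, -a ∈ ctx.Pos → b ∈ ctx.Pos →
      w (a, (m : ℚ), 0) = ctx.emb b → 1 ≤ m := by
    intro a b m ha hb hwa
    by_contra! hm
    have h := ctx.map_mem_PosHat_of_not_form hw (a := -a) (k := -m)
      (ctx.mem_PosHat_iff.2 (by
        rcases (by omega : m = 0 ∨ m < 0) with h | h
        · exact Or.inl ⟨by omega, ha⟩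
        · exact Or.inr ⟨by omega, ctx.pos_subset ha⟩)) (fun _ => ha)
    have he : ((-a, ((-m : ℤ) : ℚ), 0) : V × ℚ × ℚ) = -(a, (m : ℚ), 0) := by simp
    rw [he, map_neg, hwa] at h
    exact ctx.neg_notMem_PosHat (ctx.emb_mem_PosHat hb) h
  have hk1 : k = 1 := by
    have := hlevel hνpos hα.1 hwk
    have := hlevel hξpos hμα hwl
    omega
  have hwν : w (ctx.emb (-ν')) = ctx.δhat - ctx.emb α := by
    have he : ctx.emb (-ν') = ctx.δhat - (ν', (k : ℚ), 0) := by
      simp [RootSystemCtx.emb, RootSystemCtx.δhat, hk1]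
    rw [he, map_sub, hδ, hwk]
  refine ⟨insert (-ν') (ctx.idealOf w), ctx.isAbelianIdeal_insert hw hα hνpos hwν,
    Set.ssubset_insert fun hmem => ?_⟩
  have h := ((ctx.mem_idealOf_iff hw.1).1 hmem).2
  rw [hwν, sub_sub_cancel_left] at h
  exact ctx.neg_notMem_PosHat (ctx.emb_mem_PosHat hα.1) h
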